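/- In the fragmented-society model, let σ be a distribution whose support consists of (h,N^h,{0}) with weight α>0 together with platforms of the form (ℓ,N^ℓ∖S,S) for S∈𝒮 with S⊆N∖N^h, with weights σ̄(S). Writing d=F(ℓ,N)−F(h,N), σ is an equilibrium if and only if, for every feasible S with S⊆N∖N^h, α·(d−F(ℓ,S))/F(h,N) ≤ Σ_{S′∈𝒮: S′⊇S} σ̄(S′), with equality whenever σ̄(S)>0. -/

import Mathlib

open Finset
open scoped Classical

/-- A policy: `l` (the "populist" policy ℓ) or `h` (the rational policy). -/
inductive Policy where
  | l : Policy
  | h : Policy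
  deriving DecidableEq

instance : Fintype Policy :=
  ⟨{Policy.l, Policy.h}, fun x => by cases x <;> simp⟩

/-- A narrative `S ⊆ {0,…,n}`: the first component records whether the policy
variable (index 0) belongs to `S`, the second records `S ∩ N`. -/
abbrev Narrative (n : ℕ) := Bool × Finset (Fin n)

/-- A platform: a policy, a coalition of social groups, and a narrative. -/
abbrev Platform (n : ℕ) := Policy × Finset (Fin n) × Narrative n

namespace FN

variable {n : ℕ}

/-- The true narrative `S = {0}`. -/
def trueNarr (n : ℕ) : Narrative n := (true, ∅)

/-- The denialist narrative `S = ∅`. -/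
def denialNarr (n : ℕ) : Narrative n := (false, ∅)

/-- `x_S(a,C) = x_S(a',C')`: the variables postulated by the narrative `S` take the
same values at `(a,C)` and `(a',C')`. -/
def Agrees (S : Narrative n) (a : Policy) (C : Finset (Fin n))
    (a' : Policy) (C' : Finset (Fin n)) : Prop :=
  (S.1 = true → a = a') ∧ ∀ i ∈ S.2, (i ∈ C ↔ i ∈ C')

/-- The long-run conditional probability `p_σ(y = 1 ∣ x_S(a,C))`: using
`Pr(y=1∣h) = q`, `Pr(y=1∣ℓ) = 0`, it is `q` times the σ-mass of platforms with
policy `h` agreeing with `(a,C)` on `S`, divided by the σ-mass of all platforms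
agreeing with `(a,C)` on `S`. -/
noncomputable def condProb (q : ℝ) (σ : Platform n → ℝ) (a : Policy)
    (C : Finset (Fin n)) (S : Narrative n) : ℝ :=
  (q * ∑ z ∈ univ.filter (fun z : Platform n =>
      z.1 = Policy.h ∧ Agrees S a C z.1 z.2.1), σ z) /
    ∑ z ∈ univ.filter (fun z : Platform n => Agrees S a C z.1 z.2.1), σ z

/-- The platform payoff `U_σ(a,C,S) = Σ_{i∈C} p_σ(y=1∣x_S(a,C)) · f_i(a)`. -/
noncomputable def payoff (q : ℝ) (f : Fin n → Policy → ℝ) (σ : Platform n → ℝ)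
    (z : Platform n) : ℝ :=
  ∑ i ∈ z.2.1, condProb q σ z.1 z.2.1 z.2.2 * f i z.1

/-- A coalition `C` is admissible given policy `a` if it is a nonempty strict
subset of `N` and every member intrinsically supports `a`. -/
def Admissible (f : Fin n → Policy → ℝ) (a : Policy) (C : Finset (Fin n)) : Prop :=
  C.Nonempty ∧ C ≠ univ ∧ ∀ i ∈ C, 0 < f i a

/-- A valid platform: admissible coalition and feasible narrative. -/
def Valid (f : Fin n → Policy → ℝ) (feas : Narrative n → Prop) (z : Platform n) : Prop :=
  Admissible f z.1 z.2.1 ∧ feas z.2.2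

/-- `σ` is a probability distribution over platforms. -/
def IsDist (σ : Platform n → ℝ) : Prop :=
  (∀ z, 0 ≤ σ z) ∧ ∑ z, σ z = 1

/-- An ε-equilibrium: a full-support distribution (over valid platforms) such that
every platform with probability above ε maximizes the payoff among valid platforms. -/
def EpsEquilibrium (q : ℝ) (f : Fin n → Policy → ℝ) (feas : Narrative n → Prop)
    (ε : ℝ) (σ : Platform n → ℝ) : Prop :=
  IsDist σ ∧ (∀ z, 0 < σ z ↔ Valid f feas z) ∧
    ∀ z, Valid f feas z → ε < σ z →
      ∀ z', Valid f feas z' → payoff q f σ z' ≤ payoff q f σ z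

/-- An equilibrium: a (pointwise) limit of ε-equilibria as ε → 0. -/
def Equilibrium (q : ℝ) (f : Fin n → Policy → ℝ) (feas : Narrative n → Prop)
    (σ : Platform n → ℝ) : Prop :=
  ∃ (ε : ℕ → ℝ) (σs : ℕ → Platform n → ℝ),
    (∀ k, 0 < ε k) ∧ Filter.Tendsto ε Filter.atTop (nhds 0) ∧
    (∀ k, EpsEquilibrium q f feas (ε k) (σs k)) ∧
    (∀ z, Filter.Tendsto (fun k => σs k z) Filter.atTop (nhds (σ z)))

/-- An essential equilibrium: supported platforms with a false narrative strictly
outperform the true narrative on the same policy-coalition pair, and supported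
narratives `S ⊆ N` strictly outperform all strict subset narratives. -/
def Essential (q : ℝ) (f : Fin n → Policy → ℝ) (feas : Narrative n → Prop)
    (σ : Platform n → ℝ) : Prop :=
  Equilibrium q f feas σ ∧
  (∀ a C (S : Narrative n), 0 < σ (a, C, S) → S ≠ trueNarr n →
      payoff q f σ (a, C, trueNarr n) < payoff q f σ (a, C, S)) ∧
  (∀ a C (S : Finset (Fin n)), 0 < σ (a, C, ((false, S) : Narrative n)) →
      ∀ S' : Finset (Fin n), S' ⊂ S →
        payoff q f σ (a, C, ((false, S') : Narrative n)) <
          payoff q f σ (a, C, ((false, S) : Narrative n)))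

/-- `N^a`: the set of groups with positive mobilization potential for `a`. -/
noncomputable def Nset (f : Fin n → Policy → ℝ) (a : Policy) : Finset (Fin n) :=
  univ.filter (fun i => 0 < f i a)

/-- `F(a,M) = Σ_{i∈M} f_i(a)`: the aggregate mobilization potential for `a` in `M`. -/
def Fval (f : Fin n → Policy → ℝ) (a : Policy) (M : Finset (Fin n)) : ℝ :=
  ∑ i ∈ M, f i a

/-- Standing assumptions on the mobilization potentials: nonnegativity, every group
supports some policy, every policy is supported by some group. -/
def FOK (f : Fin n → Policy → ℝ) : Prop :=
  (∀ i a, 0 ≤ f i a) ∧ (∀ i, ∃ a, 0 < f i a) ∧ (∀ a, ∃ i, 0 < f i a)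

/-- Standing assumptions on the family `𝒮` in the fragmented-society model. -/
def FamilyOK (f : Fin n → Policy → ℝ) (𝒮 : Finset (Finset (Fin n))) : Prop :=
  (univ \ Nset f Policy.h).Nonempty ∧ (univ \ Nset f Policy.l).Nonempty ∧
  (Nset f Policy.l ∩ Nset f Policy.h).Nonempty ∧
  univ \ Nset f Policy.h ∈ 𝒮 ∧ univ \ Nset f Policy.l ∈ 𝒮 ∧
  Nset f Policy.l ∩ Nset f Policy.h ∈ 𝒮 ∧ (∅ : Finset (Fin n)) ∈ 𝒮 ∧
  ∀ S ∈ 𝒮, S ⊆ univ \ Nset f Policy.h ∨ S ⊆ univ \ Nset f Policy.l ∨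
    S ⊆ Nset f Policy.l ∩ Nset f Policy.h

/-- In the fragmented-society model, a narrative is feasible iff `S ∖ {0} ∈ 𝒮`. -/
def fragFeas (𝒮 : Finset (Finset (Fin n))) : Narrative n → Prop :=
  fun S => S.2 ∈ 𝒮

end FN

namespace FN

variable {n : ℕ}

lemma sum_sigma_aux (L : Finset (Fin n)) (z0 : Platform n)
    (𝒮 : Finset (Finset (Fin n))) (α : ℝ) (σbar : Finset (Fin n) → ℝ)
    (σ : Platform n → ℝ)
    (h : ∀ z : Platform n, σ z = (if z = z0 then α else 0) +
      ∑ S ∈ 𝒮, if z = ((Policy.l, L \ S, ((false, S) : Narrative n)) : Platform n)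
        then σbar S else 0)
    (P : Platform n → Prop) [DecidablePred P] :
    ∑ z ∈ univ.filter P, σ z = (if P z0 then α else 0) +
      ∑ S ∈ 𝒮, if P (Policy.l, L \ S, (false, S)) then σbar S else 0 := by
  rw [Finset.sum_congr rfl (fun z _ => h z), Finset.sum_add_distrib, Finset.sum_comm]
  congr 1
  · rw [Finset.sum_ite_eq']
    simp
  · apply Finset.sum_congr rfl
    intro S _
    rw [Finset.sum_ite_eq']
    simp

lemma sigma_eq (L H : Finset (Fin n))
    (𝒮 : Finset (Finset (Fin n))) (α : ℝ) (σbar : Finset (Fin n) → ℝ)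
    (hbar0 : ∀ S : Finset (Fin n), (S ∉ 𝒮 ∨ ¬ S ⊆ univ \ H) → σbar S = 0)
    (σ : Platform n → ℝ)
    (hσdef : ∀ z : Platform n, σ z =
        if z = ((Policy.h, H, FN.trueNarr n) : Platform n) then α
        else if z.1 = Policy.l ∧ z.2.2.1 = false ∧
            z.2.1 = L \ z.2.2.2 ∧ z.2.2.2 ∈ 𝒮 ∧
            z.2.2.2 ⊆ univ \ H
          then σbar z.2.2.2 else 0) (z : Platform n) :
    σ z = (if z = ((Policy.h, H, FN.trueNarr n) : Platform n) then α else 0) +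
      ∑ S ∈ 𝒮, if z = ((Policy.l, L \ S, ((false, S) : Narrative n)) : Platform n)
        then σbar S else 0 := by
  rw [hσdef]
  obtain ⟨a, C, b, T⟩ := z
  cases a with
  | h => simp
  | l =>
    simp only [Prod.mk.injEq, reduceCtorEq, false_and, if_false, true_and, zero_add]
    rw [Finset.sum_eq_single T]
    · by_cases h1 : T ∈ 𝒮 <;> by_cases h2 : T ⊆ univ \ H
      · simp only [h1, h2, and_true]
        congr 1
        exact propext and_comm
      · simp [hbar0 T (Or.inr h2)]
      · simp [h1, hbar0 T (Or.inl h1)]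
      · simp [hbar0 T (Or.inr h2)]
    · intro S _ hS
      rw [if_neg]
      rintro ⟨_, _, h⟩
      exact hS h.symm
    · intro h1
      simp [hbar0 T (Or.inl h1)]

lemma condProb_eq (q : ℝ) (L H : Finset (Fin n))
    (𝒮 : Finset (Finset (Fin n))) (α : ℝ) (σbar : Finset (Fin n) → ℝ)
    (σ : Platform n → ℝ)
    (h : ∀ z : Platform n, σ z =
      (if z = ((Policy.h, H, FN.trueNarr n) : Platform n) then α else 0) +
      ∑ S ∈ 𝒮, if z = ((Policy.l, L \ S, ((false, S) : Narrative n)) : Platform n)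
        then σbar S else 0)
    (a : Policy) (C : Finset (Fin n)) (T : Narrative n) :
    condProb q σ a C T = (q * if Agrees T a C Policy.h H then α else 0) /
      ((if Agrees T a C Policy.h H then α else 0) +
        ∑ S ∈ 𝒮, if Agrees T a C Policy.l (L \ S) then σbar S else 0) := by
  unfold condProb
  rw [sum_sigma_aux L _ 𝒮 α σbar σ h, sum_sigma_aux L _ 𝒮 α σbar σ h]
  simp

lemma payoff_eq (q : ℝ) (f : Fin n → Policy → ℝ) (σ : Platform n → ℝ)
    (a : Policy) (C : Finset (Fin n)) (T : Narrative n) :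
    payoff q f σ (a, C, T) = condProb q σ a C T * Fval f a C := by
  simp [payoff, Fval, Finset.mul_sum]

end FN

/-- In the fragmented-society model, let `σ` be a distribution whose
support consists of `(h,N^h,{0})` with weight `α > 0` together with platforms of the
form `(ℓ, N^ℓ∖S, S)` for feasible `S ⊆ N∖N^h`, with weights `σ̄(S)`. Writing
`d = F(ℓ,N) − F(h,N)`, `σ` is an equilibrium (every valid platform gets payoff at
most `U* = q·F(h,N^h)`, with equality on the support) if and only if, for every
feasible `S ⊆ N∖N^h`,
`α·(d − F(ℓ,S))/F(h,N) ≤ Σ_{S′∈𝒮 : S′⊇S} σ̄(S′)`,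
with equality whenever `σ̄(S) > 0`. -/
theorem frag_equilibrium_characterization
    (n : ℕ) (q : ℝ) (hq0 : 0 < q) (hq1 : q ≤ 1)
    (f : Fin n → Policy → ℝ) (hf : FN.FOK f)
    (𝒮 : Finset (Finset (Fin n))) (h𝒮 : FN.FamilyOK f 𝒮)
    (α : ℝ) (hα : 0 < α)
    (σbar : Finset (Fin n) → ℝ) (hbarnn : ∀ S, 0 ≤ σbar S)
    (hbar0 : ∀ S : Finset (Fin n),
        (S ∉ 𝒮 ∨ ¬ S ⊆ univ \ FN.Nset f Policy.h) → σbar S = 0)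
    (σ : Platform n → ℝ)
    (hσdef : ∀ z : Platform n, σ z =
        if z = ((Policy.h, FN.Nset f Policy.h, FN.trueNarr n) : Platform n) then α
        else if z.1 = Policy.l ∧ z.2.2.1 = false ∧
            z.2.1 = FN.Nset f Policy.l \ z.2.2.2 ∧ z.2.2.2 ∈ 𝒮 ∧
            z.2.2.2 ⊆ univ \ FN.Nset f Policy.h
          then σbar z.2.2.2 else 0)
    (hdist : FN.IsDist σ) :
    (∀ z : Platform n, FN.Valid f (FN.fragFeas 𝒮) z →
        FN.payoff q f σ z ≤ q * FN.Fval f Policy.h (FN.Nset f Policy.h) ∧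
        (0 < σ z →
          FN.payoff q f σ z = q * FN.Fval f Policy.h (FN.Nset f Policy.h)))
    ↔
    (∀ S ∈ 𝒮, S ⊆ univ \ FN.Nset f Policy.h →
        α * ((FN.Fval f Policy.l univ - FN.Fval f Policy.h univ) -
              FN.Fval f Policy.l S) / FN.Fval f Policy.h univ ≤
          ∑ S' ∈ 𝒮.filter (fun S' => S ⊆ S'), σbar S' ∧
        (0 < σbar S →
          α * ((FN.Fval f Policy.l univ - FN.Fval f Policy.h univ) -
                FN.Fval f Policy.l S) / FN.Fval f Policy.h univ =
            ∑ S' ∈ 𝒮.filter (fun S' => S ⊆ S'), σbar S')) := by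
  obtain ⟨hnn, hcov, -⟩ := hf
  obtain ⟨hA, hB, hM, hA𝒮, hB𝒮, hM𝒮, hE𝒮, hcase⟩ := h𝒮
  have hσ := FN.sigma_eq (FN.Nset f Policy.l) (FN.Nset f Policy.h) 𝒮 α σbar hbar0 σ hσdef
  have hcp := FN.condProb_eq q _ _ 𝒮 α σbar σ hσ
  have memN : ∀ a i, i ∈ FN.Nset f a ↔ 0 < f i a := by intro a i; simp [FN.Nset]
  have hFN : ∀ a, FN.Fval f a (FN.Nset f a) = FN.Fval f a univ := by
    intro a
    apply Finset.sum_subset (Finset.subset_univ _)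
    intro i _ hi
    rw [memN] at hi
    exact le_antisymm (not_lt.mp hi) (hnn i a)
  have hmono : ∀ a C D, C ⊆ D → FN.Fval f a C ≤ FN.Fval f a D := by
    intro a C D h
    exact Finset.sum_le_sum_of_subset_of_nonneg h (fun i _ _ => hnn i a)
  have hF0 : ∀ a C, 0 ≤ FN.Fval f a C := fun a C => Finset.sum_nonneg (fun i _ => hnn i a)
  have hFh : 0 < FN.Fval f Policy.h univ := by
    obtain ⟨i, hi⟩ := hM
    rw [Finset.mem_inter, memN, memN] at hi
    exact lt_of_lt_of_le hi.2 (Finset.single_le_sum (f := fun i => f i Policy.h)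
      (fun i _ => hnn i _) (Finset.mem_univ i))
  have hAl : ∀ i, i ∉ FN.Nset f Policy.h → i ∈ FN.Nset f Policy.l := by
    intro i hi
    obtain ⟨a, ha⟩ := hcov i
    cases a with
    | l => exact (memN _ _).2 ha
    | h => exact absurd ((memN _ _).2 ha) hi
  have hdiff : ∀ T, FN.Fval f Policy.l (FN.Nset f Policy.l \ T) =
      FN.Fval f Policy.l univ - FN.Fval f Policy.l T := by
    intro T
    have h1 : FN.Fval f Policy.l (FN.Nset f Policy.l \ T) = FN.Fval f Policy.l (univ \ T) := by
      apply Finset.sum_subset (Finset.sdiff_subset_sdiff (Finset.subset_univ _) le_rfl)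
      intro i hi hi'
      simp only [Finset.mem_sdiff, Finset.mem_univ, true_and] at hi hi'
      have : ¬ 0 < f i Policy.l := fun h => hi' ⟨(memN _ _).2 h, hi⟩
      exact le_antisymm (not_lt.mp this) (hnn _ _)
    rw [h1, eq_sub_iff_add_eq]
    exact Finset.sum_sdiff (Finset.subset_univ T)
  have hsupnn : ∀ P : Finset (Fin n) → Prop, 0 ≤ ∑ S ∈ 𝒮, if P S then σbar S else 0 := by
    intro P
    apply Finset.sum_nonneg
    intro S _
    split_ifs
    · exact hbarnn S
    · exact le_rfl
  have hcp_le : ∀ a C T, FN.condProb q σ a C T ≤ q := by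
    intro a C T
    rw [hcp]
    have := hsupnn (fun S => FN.Agrees T a C Policy.l (FN.Nset f Policy.l \ S))
    split_ifs
    · apply div_le_of_le_mul₀ (by positivity) hq0.le
      nlinarith
    · simp [hq0.le]
  -- narratives inside the groups opposed to h
  have keyA : ∀ C T, T ⊆ univ \ FN.Nset f Policy.h → Disjoint C T →
      FN.condProb q σ Policy.l C (false, T) =
        q * α / (α + ∑ S' ∈ 𝒮.filter (fun S' => T ⊆ S'), σbar S') := by
    intro C T hT hCT
    have h1 : FN.Agrees (false, T) Policy.l C Policy.h (FN.Nset f Policy.h) := by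
      refine ⟨by simp, fun i hi => ?_⟩
      have h2 := Finset.mem_sdiff.1 (hT hi)
      have h3 := Finset.disjoint_right.1 hCT hi
      exact iff_of_false h3 h2.2
    rw [hcp, if_pos h1, Finset.sum_filter]
    congr 2
    apply Finset.sum_congr rfl
    intro S _
    congr 1
    apply propext
    constructor
    · rintro ⟨-, h⟩ i hi
      have h2 := Finset.mem_sdiff.1 (hT hi)
      have h3 := Finset.disjoint_right.1 hCT hi
      have h4 := (not_congr (h i hi)).1 h3
      rw [Finset.mem_sdiff] at h4
      by_contra h5
      exact h4 ⟨hAl i h2.2, h5⟩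
    · intro h
      refine ⟨by simp, fun i hi => ?_⟩
      have h3 := Finset.disjoint_right.1 hCT hi
      refine iff_of_false h3 ?_
      rw [Finset.mem_sdiff]
      exact fun h5 => h5.2 (h hi)
  have hsum : ∀ T : Finset (Fin n), 0 ≤ ∑ S' ∈ 𝒮.filter (fun S' => T ⊆ S'), σbar S' :=
    fun T => Finset.sum_nonneg (fun S _ => hbarnn S)
  have hvalid : ∀ S ∈ 𝒮, S ⊆ univ \ FN.Nset f Policy.h →
      FN.Valid f (FN.fragFeas 𝒮) (Policy.l, FN.Nset f Policy.l \ S, (false, S)) := by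
    intro S hS hSA
    refine ⟨⟨?_, ?_, ?_⟩, hS⟩
    · obtain ⟨i, hi⟩ := hM
      rw [Finset.mem_inter] at hi
      exact ⟨i, Finset.mem_sdiff.2 ⟨hi.1, fun h => (Finset.mem_sdiff.1 (hSA h)).2 hi.2⟩⟩
    · obtain ⟨i, hi⟩ := hB
      intro h
      have : i ∈ FN.Nset f Policy.l \ S := by
        simp only at h
        rw [h]; exact Finset.mem_univ i
      exact (Finset.mem_sdiff.1 hi).2 (Finset.mem_sdiff.1 this).1
    · intro i hi
      exact (memN _ _).1 (Finset.mem_sdiff.1 hi).1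
  have hpay : ∀ S, S ⊆ univ \ FN.Nset f Policy.h →
      FN.payoff q f σ (Policy.l, FN.Nset f Policy.l \ S, (false, S)) =
        q * α / (α + ∑ S' ∈ 𝒮.filter (fun S' => S ⊆ S'), σbar S') *
          (FN.Fval f Policy.l univ - FN.Fval f Policy.l S) := by
    intro S hS
    rw [FN.payoff_eq, keyA _ _ hS Finset.sdiff_disjoint, hdiff]
  have harith_le : ∀ X G Fh : ℝ, 0 < Fh → 0 ≤ X →
      (q * α / (α + X) * G ≤ q * Fh ↔ α * (G - Fh) / Fh ≤ X) := by
    intro X G Fh hF hX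
    have hp : 0 < α + X := by linarith
    rw [div_mul_eq_mul_div, div_le_iff₀ hp, div_le_iff₀ hF, mul_assoc, mul_assoc,
      mul_le_mul_iff_right₀ hq0]
    constructor <;> intro h <;> nlinarith
  have harith_eq : ∀ X G Fh : ℝ, 0 < Fh → 0 ≤ X →
      (q * α / (α + X) * G = q * Fh ↔ α * (G - Fh) / Fh = X) := by
    intro X G Fh hF hX
    have hp : 0 < α + X := by linarith
    rw [div_mul_eq_mul_div, div_eq_iff hp.ne', div_eq_iff hF.ne', mul_assoc, mul_assoc,
      mul_right_inj' hq0.ne']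
    constructor <;> intro h <;> linarith
  have hre : ∀ S, FN.Fval f Policy.l univ - FN.Fval f Policy.h univ - FN.Fval f Policy.l S =
      FN.Fval f Policy.l univ - FN.Fval f Policy.l S - FN.Fval f Policy.h univ := by
    intro S; ring
  have hσS : ∀ S ∈ 𝒮, S ⊆ univ \ FN.Nset f Policy.h →
      σ (Policy.l, FN.Nset f Policy.l \ S, (false, S)) = σbar S := by
    intro S hS hSA
    rw [hσdef, if_neg (by simp), if_pos ⟨rfl, rfl, rfl, hS, hSA⟩]
  rw [hFN Policy.h]
  constructor
  · intro H S hS hSA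
    have h1 := H _ (hvalid S hS hSA)
    rw [hpay S hSA, hσS S hS hSA, harith_le _ _ _ hFh (hsum S),
      harith_eq _ _ _ hFh (hsum S)] at h1
    rw [hre]
    exact h1
  · intro H
    have H1 : ∀ S ∈ 𝒮, S ⊆ univ \ FN.Nset f Policy.h →
        q * α / (α + ∑ S' ∈ 𝒮.filter (fun S' => S ⊆ S'), σbar S') *
          (FN.Fval f Policy.l univ - FN.Fval f Policy.l S) ≤ q * FN.Fval f Policy.h univ := by
      intro S hS hSA
      rw [harith_le _ _ _ hFh (hsum S), ← hre]
      exact (H S hS hSA).1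
    rintro ⟨a, C, b, T⟩ ⟨⟨hC1, hC2, hC3⟩, hT⟩
    simp only at hC1 hC2 hC3
    have hT : T ∈ 𝒮 := hT
    constructor
    · rw [FN.payoff_eq]
      cases a with
      | h => exact mul_le_mul (hcp_le _ _ _) (hmono _ _ _ (Finset.subset_univ _)) (hF0 _ _) hq0.le
      | l =>
        have hpos : 0 ≤ q * FN.Fval f Policy.h univ := by positivity
        have hCl : C ⊆ FN.Nset f Policy.l := fun i hi => (memN _ _).2 (hC3 i hi)
        by_cases hag : FN.Agrees (b, T) Policy.l C Policy.h (FN.Nset f Policy.h)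
        swap
        · rw [hcp, if_neg hag]
          simpa using hpos
        have hb : b = false := by
          cases b with
          | false => rfl
          | true => exact absurd (hag.1 rfl) (by simp)
        subst hb
        have casA : T ⊆ univ \ FN.Nset f Policy.h →
            FN.condProb q σ Policy.l C (false, T) * FN.Fval f Policy.l C ≤
              q * FN.Fval f Policy.h univ := by
          intro hTA
          have hd : Disjoint C T := by
            rw [Finset.disjoint_right]
            intro i hi hiC
            exact (Finset.mem_sdiff.1 (hTA hi)).2 ((hag.2 i hi).1 hiC)
          rw [keyA C T hTA hd]
          refine le_trans ?_ (H1 T hT hTA)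
          rw [← hdiff]
          apply mul_le_mul_of_nonneg_left
          · apply hmono
            intro i hi
            exact Finset.mem_sdiff.2 ⟨hCl hi, Finset.disjoint_left.1 hd hi⟩
          · have := hsum T
            positivity
        rcases hcase T hT with h | h | h
        · exact casA h
        · apply casA
          intro i hi
          refine Finset.mem_sdiff.2 ⟨Finset.mem_univ _, fun hh => ?_⟩
          exact (Finset.mem_sdiff.1 (h hi)).2 (hCl ((hag.2 i hi).2 hh))
        · refine le_trans ?_ (H1 ∅ hE𝒮 (Finset.empty_subset _))
          have h0 : FN.Fval f Policy.l ∅ = 0 := by simp [FN.Fval]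
          have hc : FN.condProb q σ Policy.l C (false, T) =
              q * α / (α + ∑ S' ∈ 𝒮.filter (fun S' => ∅ ⊆ S'), σbar S') := by
            rw [hcp, if_pos hag, Finset.sum_filter]
            congr 2
            apply Finset.sum_congr rfl
            intro S hS
            rw [if_pos (Finset.empty_subset _)]
            by_cases hSA : S ⊆ univ \ FN.Nset f Policy.h
            · rw [if_pos]
              refine ⟨by simp, fun i hi => ?_⟩
              have hiM := Finset.mem_inter.1 (h hi)
              refine iff_of_true ((hag.2 i hi).2 hiM.2) ?_
              exact Finset.mem_sdiff.2 ⟨hiM.1, fun hh => (Finset.mem_sdiff.1 (hSA hh)).2 hiM.2⟩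
            · rw [hbar0 S (Or.inr hSA)]
              simp
          rw [hc, h0, sub_zero]
          apply mul_le_mul_of_nonneg_left (hmono _ _ _ (Finset.subset_univ _))
          have := hsum ∅
          positivity
    · intro hpos
      rw [hσdef] at hpos
      split_ifs at hpos with h1 h2
      · rw [h1, FN.payoff_eq, hcp, hFN]
        have hs : ∀ S, ¬ FN.Agrees (FN.trueNarr n) Policy.h (FN.Nset f Policy.h) Policy.l
            (FN.Nset f Policy.l \ S) := by
          intro S h
          exact absurd (h.1 rfl) (by simp)
        rw [if_pos ⟨fun _ => rfl, fun i _ => Iff.rfl⟩]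
        simp only [hs, if_false, Finset.sum_const_zero, add_zero]
        field_simp
      · obtain ⟨e1, e2, e3, e4, e5⟩ := h2
        simp only at e1 e2 e3 e4 e5 hpos
        subst e1 e2 e3
        rw [hpay T e5, harith_eq _ _ _ hFh (hsum T), ← hre]
        exact (H T e4 e5).2 hpos
      · exact absurd hpos (lt_irrefl _)
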